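/- Suppose the set B⁻ is nonempty. Then the set R⁻ = {s ∈ ℝ : ∃x₀ with (s,x₀) ∈ B⁻} is either all of ℝ or an open negative half-line (−∞, β₀) for some β₀ ∈ ℝ; there is a function a : R⁻ → (−∞, m) which is a solution of x' = h(t,x) on R⁻ and satisfies B⁻_s = (−∞, a(s)] for every s ∈ R⁻; moreover, for s ∈ R⁻ the solution x(t,s,x₀) is bounded as t → −∞ if and only if x₀ ≤ a(s); and if sup R⁻ < ∞, then a(t) → −∞ as t → (sup R⁻)⁻. -/

import Mathlib

open Set Filter

/-- The family of maximal solutions `t ↦ X t s x₀` of the scalar ODE `x' = h (t, x)`: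
for each initial pair `(s, x₀)`, `X · s x₀` is the solution with value `x₀` at time `s`,
defined on its maximal (open) interval of existence `dom s x₀`. -/
structure MaxSolFamily (h : ℝ → ℝ → ℝ) where
  X : ℝ → ℝ → ℝ → ℝ
  dom : ℝ → ℝ → Set ℝ
  dom_open : ∀ s x₀, IsOpen (dom s x₀)
  dom_ordConn : ∀ s x₀, (dom s x₀).OrdConnected
  mem_dom : ∀ s x₀, s ∈ dom s x₀
  init : ∀ s x₀, X s s x₀ = x₀
  sol : ∀ s x₀, ∀ t ∈ dom s x₀, HasDerivAt (fun τ => X τ s x₀) (h t (X t s x₀)) t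
  maximal : ∀ s x₀ (y : ℝ → ℝ) (I : Set ℝ), IsOpen I → I.OrdConnected → s ∈ I →
      y s = x₀ → (∀ t ∈ I, HasDerivAt y (h t (y t)) t) →
      I ⊆ dom s x₀ ∧ ∀ t ∈ I, y t = X t s x₀

/-- The set `B⁻` of initial pairs whose solution is bounded above in the past
(on the part of its maximal interval up to the initial time). -/
def Bminus {h : ℝ → ℝ → ℝ} (F : MaxSolFamily h) : Set (ℝ × ℝ) :=
  {sx | BddAbove ((fun t => F.X t sx.1 sx.2) '' (F.dom sx.1 sx.2 ∩ Iic sx.1))}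

/-- `R⁻ = {s : ∃ x₀, (s, x₀) ∈ B⁻}`. -/
def Rminus {h : ℝ → ℝ → ℝ} (F : MaxSolFamily h) : Set ℝ :=
  {s | ∃ x₀, (s, x₀) ∈ Bminus F}

/-- The solution `X · s x₀` is (defined and) bounded as `t → −∞`. -/
def BddAtBot {h : ℝ → ℝ → ℝ} (F : MaxSolFamily h) (s x₀ : ℝ) : Prop :=
  ∃ C : ℝ, ∀ᶠ t in atBot, t ∈ F.dom s x₀ ∧ |F.X t s x₀| ≤ C

namespace MaxSolFamily

variable {h : ℝ → ℝ → ℝ}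

/-- The time reversal of a family of maximal solutions. -/
def reverse (F : MaxSolFamily h) : MaxSolFamily fun t x => -h (-t) x where
  X t s x := F.X (-t) (-s) x
  dom s x := Neg.neg ⁻¹' F.dom (-s) x
  dom_open s x := (F.dom_open _ _).preimage continuous_neg
  dom_ordConn s x := ⟨fun a ha b hb c hc =>
    (F.dom_ordConn (-s) x).out hb ha ⟨neg_le_neg hc.2, neg_le_neg hc.1⟩⟩
  mem_dom s x := F.mem_dom _ _
  init s x := F.init _ _
  sol s x t ht := by
    exact (HasDerivAt.scomp t (F.sol (-s) x (-t) ht) (hasDerivAt_neg t)).congr_deriv (by simp)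
  maximal s x y I hI hI' hs hy hsol := by
    have key := F.maximal (-s) x (fun t => y (-t)) (Neg.neg ⁻¹' I) (hI.preimage continuous_neg)
      ⟨fun a ha b hb c hc => hI'.out hb ha ⟨neg_le_neg hc.2, neg_le_neg hc.1⟩⟩
      (by simpa using hs) (by simpa using hy)
      (fun t ht => (HasDerivAt.scomp t (hsol (-t) ht) (hasDerivAt_neg t)).congr_deriv (by simp))
    exact ⟨fun t ht => key.1 (by simpa using ht),
      fun t ht => by simpa using key.2 (-t) (by simpa using ht)⟩

lemma continuousOn (F : MaxSolFamily h) (s x : ℝ) :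
    ContinuousOn (fun t => F.X t s x) (F.dom s x) :=
  fun t ht => (F.sol s x t ht).continuousAt.continuousWithinAt

lemma mem_dom_of_Ico_subset (hcont : Continuous fun q : ℝ × ℝ => h q.1 q.2)
    (F : MaxSolFamily h) {s x b C : ℝ} (hsb : s < b) (hdom : Ico s b ⊆ F.dom s x)
    (hC : ∀ t ∈ Ico s b, |F.X t s x| ≤ C) : b ∈ F.dom s x := by
  obtain ⟨K, hK⟩ := (isCompact_Icc (a := s) (b := b)).prod (isCompact_Icc (a := -C) (b := C))
    |>.exists_bound_of_continuousOn hcont.continuousOn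
  have hlip : LipschitzOnWith K.toNNReal (fun t => F.X t s x) (Ico s b) := by
    refine (convex_Ico s b).lipschitzOnWith_of_nnnorm_hasDerivWithin_le
      (f' := fun t => h t (F.X t s x))
      (fun t ht => (F.sol s x t (hdom ht)).hasDerivWithinAt) fun t ht => ?_
    rw [← NNReal.coe_le_coe]
    exact (hK (t, F.X t s x) ⟨Ico_subset_Icc_self ht, abs_le.1 (hC t ht)⟩).trans
      (Real.le_coe_toNNReal K)
  obtain ⟨g, hg, hgeq⟩ := hlip.extend_real
  set y : ℝ → ℝ := fun t => if t < b then F.X t s x else F.X t b (g b) with hy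
  have y_left : ∀ t, t < b → y t = F.X t s x := fun t ht => if_pos ht
  have y_right : ∀ t, b ≤ t → y t = F.X t b (g b) := fun t ht => if_neg ht.not_gt
  have yb : y b = g b := by rw [y_right b le_rfl, F.init]
  have y_deriv_left : ∀ t ∈ F.dom s x, t < b → HasDerivAt y (h t (y t)) t := by
    intro t ht htb
    rw [y_left t htb]
    refine (F.sol s x t ht).congr_of_eventuallyEq ?_
    filter_upwards [Iio_mem_nhds htb] with τ hτ using y_left τ hτ
  have y_deriv_right : ∀ t ∈ F.dom b (g b), b < t → HasDerivAt y (h t (y t)) t := by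
    intro t ht htb
    rw [y_right t htb.le]
    refine (F.sol b (g b) t ht).congr_of_eventuallyEq ?_
    filter_upwards [Ioi_mem_nhds htb] with τ hτ using y_right τ (le_of_lt hτ)
  have y_g : ∀ t ∈ Ioo s b, y t = g t := fun t ht => by
    rw [y_left t ht.2]; exact hgeq (Ioo_subset_Ico_self ht)
  have y_deriv_b : HasDerivAt y (h b (y b)) b := by
    have h1 : HasDerivWithinAt y (h b (y b)) (Iic b) b := by
      refine hasDerivWithinAt_Iic_of_tendsto_deriv (s := Ioo s b)
        (fun t ht => (y_deriv_left t (hdom (Ioo_subset_Ico_self ht))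
          ht.2).differentiableAt.differentiableWithinAt)
        (hg.continuous.continuousWithinAt.congr y_g yb) (Ioo_mem_nhdsLT hsb) ?_
      have h2 : Tendsto (fun t => h t (g t)) (nhdsWithin b (Iio b)) (nhds (h b (y b))) := by
        rw [yb]
        exact ((hcont.comp (continuous_id.prodMk hg.continuous)).tendsto b).mono_left
          nhdsWithin_le_nhds
      refine h2.congr' ?_
      filter_upwards [Ioo_mem_nhdsLT hsb] with t ht
      rw [(y_deriv_left t (hdom (Ioo_subset_Ico_self ht)) ht.2).deriv, y_g t ht]
    have h3 : HasDerivWithinAt y (h b (y b)) (Ici b) b := by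
      rw [yb]
      have := F.sol b (g b) b (F.mem_dom _ _)
      rw [F.init] at this
      exact this.hasDerivWithinAt.congr (fun t ht => y_right t ht) (y_right b le_rfl)
    simpa using h1.union h3
  obtain ⟨d₁, hd₁, hd₁'⟩ := Metric.isOpen_iff.1 (F.dom_open s x) s (F.mem_dom _ _)
  obtain ⟨d₂, hd₂, hd₂'⟩ := Metric.isOpen_iff.1 (F.dom_open b (g b)) b (F.mem_dom _ _)
  rw [Real.ball_eq_Ioo] at hd₁' hd₂'
  refine (F.maximal s x y (Ioo (s - d₁) (b + d₂)) isOpen_Ioo ordConnected_Ioo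
    ⟨by linarith, by linarith⟩ (by rw [y_left s hsb, F.init]) fun t ht => ?_).1
    ⟨by linarith, by linarith⟩
  rcases lt_trichotomy t b with htb | rfl | htb
  · refine y_deriv_left t ?_ htb
    rcases lt_or_ge t s with hts | hts
    · exact hd₁' ⟨ht.1, by linarith⟩
    · exact hdom ⟨hts, htb⟩
  · exact y_deriv_b
  · exact y_deriv_right t (hd₂' ⟨by linarith, ht.2⟩) htb

lemma mem_dom_of_bounded_forward (hcont : Continuous fun q : ℝ × ℝ => h q.1 q.2)
    (F : MaxSolFamily h) {s x b C : ℝ} (hsb : s ≤ b)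
    (hC : ∀ t ∈ F.dom s x, t ∈ Icc s b → |F.X t s x| ≤ C) : b ∈ F.dom s x := by
  by_contra hb
  have hclosed : IsClosed (Icc s b ∩ (F.dom s x)ᶜ) :=
    isClosed_Icc.inter (F.dom_open s x).isClosed_compl
  have hbdd : BddBelow (Icc s b ∩ (F.dom s x)ᶜ) := ⟨s, fun t ht => ht.1.1⟩
  obtain ⟨⟨hsc, hcb⟩, hc⟩ := hclosed.csInf_mem ⟨b, ⟨hsb, le_rfl⟩, hb⟩ hbdd
  set c := sInf (Icc s b ∩ (F.dom s x)ᶜ)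
  have hdom : Ico s c ⊆ F.dom s x := fun t ht => by
    by_contra h'
    exact (csInf_le hbdd ⟨⟨ht.1, ht.2.le.trans hcb⟩, h'⟩).not_gt ht.2
  have hsc' : s < c := hsc.lt_of_ne fun e => hc (e ▸ F.mem_dom s x)
  exact hc (F.mem_dom_of_Ico_subset hcont hsc' hdom
    fun t ht => hC t (hdom ht) ⟨ht.1, ht.2.le.trans hcb⟩)

lemma mem_dom_of_bounded_backward (hcont : Continuous fun q : ℝ × ℝ => h q.1 q.2)
    (F : MaxSolFamily h) {s x b C : ℝ} (hbs : b ≤ s)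
    (hC : ∀ t ∈ F.dom s x, t ∈ Icc b s → |F.X t s x| ≤ C) : b ∈ F.dom s x := by
  have key := F.reverse.mem_dom_of_bounded_forward (s := -s) (x := x) (b := -b) (C := C)
    ((hcont.comp (continuous_neg.prodMap continuous_id)).neg) (neg_le_neg hbs)
    (fun t ht htb => by
      simp only [reverse, mem_preimage, neg_neg] at ht ⊢
      exact hC _ ht ⟨by linarith [htb.2], by linarith [htb.1]⟩)
  simpa [reverse] using key

lemma dom_subset_of_mem (F : MaxSolFamily h) {s x t : ℝ} (ht : t ∈ F.dom s x) :
    F.dom s x ⊆ F.dom t (F.X t s x) ∧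
      ∀ τ ∈ F.dom s x, F.X τ s x = F.X τ t (F.X t s x) :=
  F.maximal t (F.X t s x) (fun τ => F.X τ s x) (F.dom s x) (F.dom_open _ _) (F.dom_ordConn _ _)
    ht rfl (F.sol s x)

lemma dom_eq_of_mem (F : MaxSolFamily h) {s x t : ℝ} (ht : t ∈ F.dom s x) :
    F.dom t (F.X t s x) = F.dom s x := by
  obtain ⟨h1, h2⟩ := F.dom_subset_of_mem ht
  have hs := h1 (F.mem_dom s x)
  have h3 := (F.dom_subset_of_mem hs).1
  rw [← h2 s (F.mem_dom s x), F.init] at h3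
  exact h3.antisymm h1

lemma lt_of_lt (F : MaxSolFamily h) {s₁ x₁ s₂ x₂ t₀ t : ℝ} (h₁ : t₀ ∈ F.dom s₁ x₁)
    (h₂ : t₀ ∈ F.dom s₂ x₂) (h₁' : t ∈ F.dom s₁ x₁) (h₂' : t ∈ F.dom s₂ x₂)
    (hlt : F.X t₀ s₁ x₁ < F.X t₀ s₂ x₂) : F.X t s₁ x₁ < F.X t s₂ x₂ := by
  by_contra! hle
  have hD : (F.dom s₁ x₁ ∩ F.dom s₂ x₂).OrdConnected :=
    (F.dom_ordConn _ _).inter (F.dom_ordConn _ _)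
  obtain ⟨τ, ⟨hτ₁, hτ₂⟩, hτ⟩ := hD.isPreconnected.intermediate_value ⟨h₁', h₂'⟩ ⟨h₁, h₂⟩
    (((F.continuousOn s₂ x₂).mono inter_subset_right).sub
      ((F.continuousOn s₁ x₁).mono inter_subset_left))
    (show (0 : ℝ) ∈ _ from ⟨sub_nonpos.2 hle, sub_nonneg.2 hlt.le⟩)
  have e := (F.dom_subset_of_mem hτ₁).2 t₀ h₁
  have hτ' : F.X τ s₂ x₂ = F.X τ s₁ x₁ := sub_eq_zero.1 hτ
  rw [← hτ', ← (F.dom_subset_of_mem hτ₂).2 t₀ h₂] at e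
  exact hlt.ne e

lemma forward_le (F : MaxSolFamily h) {s x t₀ t c : ℝ} (hc : ∀ τ, h τ c < 0)
    (h₀ : t₀ ∈ F.dom s x) (ht : t ∈ F.dom s x) (htt : t₀ ≤ t) (hle : F.X t₀ s x ≤ c) :
    F.X t s x ≤ c := by
  have hsub : Icc t₀ t ⊆ F.dom s x := (F.dom_ordConn s x).out h₀ ht
  refine image_le_of_deriv_right_lt_deriv_boundary' (f' := fun τ => h τ (F.X τ s x))
    (B := fun _ => c) (B' := fun _ => 0) ((F.continuousOn s x).mono hsub)
    (fun τ hτ => (F.sol s x τ (hsub (Ico_subset_Icc_self hτ))).hasDerivWithinAt) hle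
    continuousOn_const (fun τ _ => hasDerivWithinAt_const _ _ _) (fun τ _ e => ?_)
    (right_mem_Icc.2 htt)
  simpa only [e] using hc τ

lemma mem_Bminus_iff (F : MaxSolFamily h) {s x : ℝ} :
    (s, x) ∈ Bminus F ↔ ∃ C, ∀ t ∈ F.dom s x, t ≤ s → F.X t s x ≤ C := by
  constructor
  · rintro ⟨C, hC⟩
    exact ⟨C, fun t ht hts => hC ⟨t, ⟨ht, hts⟩, rfl⟩⟩
  · rintro ⟨C, hC⟩
    exact ⟨C, by rintro _ ⟨t, ⟨ht, hts⟩, rfl⟩; exact hC t ht hts⟩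

lemma backward_ge (F : MaxSolFamily h) {s x t c : ℝ} (hc : ∀ τ, h τ c < 0) (hcx : c < x)
    (ht : t ∈ F.dom s x) (hts : t ≤ s) : c ≤ F.X t s x := by
  by_contra! hlt
  have := F.forward_le hc ht (F.mem_dom s x) hts hlt.le
  rw [F.init] at this
  exact this.not_gt hcx

section Decay

variable {ε m : ℝ}

lemma exists_abs_le_of_mem_Bminus (hε : 0 < ε)
    (hem : ∀ t x : ℝ, m ≤ x → h t x ≤ -ε ∧ h t (-x) ≤ -ε)
    (F : MaxSolFamily h) {s x : ℝ} (hx : (s, x) ∈ Bminus F) :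
    ∃ C, ∀ t ∈ F.dom s x, t ≤ s → |F.X t s x| ≤ C := by
  obtain ⟨C, hC⟩ := F.mem_Bminus_iff.1 hx
  set c := max m (-x + 1)
  have hc : ∀ τ, h τ (-c) < 0 := fun τ => ((hem τ c (le_max_left _ _)).2).trans_lt (by linarith)
  have hcx : -c < x := by linarith [le_max_right m (-x + 1)]
  refine ⟨max c C, fun t ht hts => abs_le.2 ⟨?_, (hC t ht hts).trans (le_max_right _ _)⟩⟩
  linarith [F.backward_ge hc hcx ht hts, le_max_left c C]

lemma Iic_subset_dom_of_mem_Bminus (hcont : Continuous fun q : ℝ × ℝ => h q.1 q.2) (hε : 0 < ε)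
    (hem : ∀ t x : ℝ, m ≤ x → h t x ≤ -ε ∧ h t (-x) ≤ -ε)
    (F : MaxSolFamily h) {s x : ℝ} (hx : (s, x) ∈ Bminus F) : Iic s ⊆ F.dom s x := by
  obtain ⟨C, hC⟩ := F.exists_abs_le_of_mem_Bminus hε hem hx
  exact fun b hb => F.mem_dom_of_bounded_backward hcont hb fun t ht htb => hC t ht htb.2

lemma mem_Bminus_of_mem_dom (hε : 0 < ε) (hem : ∀ t x : ℝ, m ≤ x → h t x ≤ -ε ∧ h t (-x) ≤ -ε)
    (F : MaxSolFamily h) {s x t : ℝ} (hx : (s, x) ∈ Bminus F) (ht : t ∈ F.dom s x) :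
    (t, F.X t s x) ∈ Bminus F := by
  obtain ⟨C, hC⟩ := F.mem_Bminus_iff.1 hx
  refine F.mem_Bminus_iff.2 ⟨max C (max x m), fun τ hτ _ => ?_⟩
  rw [F.dom_eq_of_mem ht] at hτ
  rw [← (F.dom_subset_of_mem ht).2 τ hτ]
  rcases le_total τ s with hτs | hτs
  · exact (hC τ hτ hτs).trans (le_max_left _ _)
  · refine (F.forward_le (c := max x m) (fun r => ?_) (F.mem_dom s x) hτ hτs
      ((F.init s x).trans_le (le_max_left _ _))).trans (le_max_right _ _)
    exact (hem r _ (le_max_right _ _)).1.trans_lt (by linarith)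

lemma le_of_mem_Bminus (hcont : Continuous fun q : ℝ × ℝ => h q.1 q.2) (hε : 0 < ε) (hm : 0 < m)
    (hem : ∀ t x : ℝ, m ≤ x → h t x ≤ -ε ∧ h t (-x) ≤ -ε)
    (F : MaxSolFamily h) {s x : ℝ} (hx : (s, x) ∈ Bminus F) : x ≤ m := by
  obtain ⟨C, hC⟩ := F.mem_Bminus_iff.1 hx
  have hdom := F.Iic_subset_dom_of_mem_Bminus hcont hε hem hx
  set r := 2 * |C| / ε
  have hr : 0 ≤ r := by positivity
  have hrC : ε / 2 * r = |C| := by simp only [r]; field_simp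
  have hsub : Icc (s - r) s ⊆ F.dom s x := fun t ht => hdom ht.2
  have hB : ∀ τ, HasDerivAt (fun τ => m + ε / 2 * (s - τ)) (-(ε / 2)) τ := fun τ => by
    simpa using (((hasDerivAt_id τ).const_sub s).const_mul (ε / 2)).const_add m
  have key := image_le_of_deriv_right_lt_deriv_boundary' (f' := fun τ => h τ (F.X τ s x))
    (B := fun τ => m + ε / 2 * (s - τ)) (B' := fun _ => -(ε / 2))
    ((F.continuousOn s x).mono hsub)
    (fun τ hτ => (F.sol s x τ (hsub (Ico_subset_Icc_self hτ))).hasDerivWithinAt)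
    (by
      have h1 := hC (s - r) (hdom (by simpa using hr)) (by linarith)
      have h2 := le_abs_self C
      simp only [sub_sub_cancel, hrC]
      linarith)
    (fun τ _ => (hB τ).continuousAt.continuousWithinAt)
    (fun τ _ => (hB τ).hasDerivWithinAt)
    (fun τ hτ e => by
      have h1 : 0 ≤ ε / 2 * (s - τ) := mul_nonneg (by linarith) (by linarith [hτ.2])
      have h2 := (hem τ (F.X τ s x) (by rw [e]; linarith)).1
      linarith)
    (right_mem_Icc.2 (by linarith : s - r ≤ s))
  simpa [F.init] using key

lemma lt_of_mem_Bminus (hcont : Continuous fun q : ℝ × ℝ => h q.1 q.2) (hε : 0 < ε) (hm : 0 < m)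
    (hem : ∀ t x : ℝ, m ≤ x → h t x ≤ -ε ∧ h t (-x) ≤ -ε)
    (F : MaxSolFamily h) {s x : ℝ} (hx : (s, x) ∈ Bminus F) : x < m := by
  refine (F.le_of_mem_Bminus hcont hε hm hem hx).lt_of_ne fun hxm => ?_
  have hdom := F.Iic_subset_dom_of_mem_Bminus hcont hε hem hx
  have hd := F.sol s x s (F.mem_dom s x)
  rw [hasDerivAt_iff_tendsto_slope] at hd
  have hnonneg : 0 ≤ h s (F.X s s x) := by
    have hsub : Iio s ⊆ {s}ᶜ := fun t ht => ne_of_lt ht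
    refine ge_of_tendsto (hd.mono_left (nhdsWithin_mono s hsub)) ?_
    filter_upwards [self_mem_nhdsWithin] with t ht
    have h1 := F.le_of_mem_Bminus hcont hε hm hem
      (F.mem_Bminus_of_mem_dom hε hem hx (hdom (mem_Iic.2 (le_of_lt ht))))
    rw [slope_def_field, F.init]
    exact div_nonneg_of_nonpos (by linarith) (sub_nonpos.2 (le_of_lt ht))
  rw [F.init] at hnonneg
  linarith [(hem s x hxm.ge).1]

lemma mem_Bminus_of_le (hcont : Continuous fun q : ℝ × ℝ => h q.1 q.2) (hε : 0 < ε)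
    (hem : ∀ t x : ℝ, m ≤ x → h t x ≤ -ε ∧ h t (-x) ≤ -ε)
    (F : MaxSolFamily h) {s x x' : ℝ} (hx : (s, x) ∈ Bminus F) (hle : x' ≤ x) :
    (s, x') ∈ Bminus F := by
  rcases hle.eq_or_lt with rfl | hlt
  · exact hx
  obtain ⟨C, hC⟩ := F.mem_Bminus_iff.1 hx
  have hdom := F.Iic_subset_dom_of_mem_Bminus hcont hε hem hx
  refine F.mem_Bminus_iff.2 ⟨C, fun t ht hts => ?_⟩
  exact (F.lt_of_lt (F.mem_dom s x') (F.mem_dom s x) ht (hdom hts)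
    (by simpa only [F.init] using hlt)).le.trans (hC t (hdom hts) hts)

lemma sSup_mem_Bminus (hcont : Continuous fun q : ℝ × ℝ => h q.1 q.2) (hε : 0 < ε) (hm : 0 < m)
    (hem : ∀ t x : ℝ, m ≤ x → h t x ≤ -ε ∧ h t (-x) ≤ -ε)
    (F : MaxSolFamily h) {s : ℝ} (hs : s ∈ Rminus F) :
    (s, sSup {x | (s, x) ∈ Bminus F}) ∈ Bminus F := by
  have hbdd : BddAbove {x | (s, x) ∈ Bminus F} :=
    ⟨m, fun x hx => F.le_of_mem_Bminus hcont hε hm hem hx⟩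
  set a := sSup {x | (s, x) ∈ Bminus F}
  by_contra ha
  obtain ⟨t, ht, hts, hmt⟩ : ∃ t ∈ F.dom s a, t ≤ s ∧ m < F.X t s a := by
    by_contra! H
    exact ha (F.mem_Bminus_iff.2 ⟨m, H⟩)
  have hsubset : Icc t s ⊆ F.dom s a := (F.dom_ordConn s a).out ht (F.mem_dom s a)
  obtain ⟨c, hmc, hca⟩ := exists_between hmt
  -- The solution through `(t, c)` stays above every solution issuing from the fibre of `Bminus`.
  have hlow : ∀ x, (s, x) ∈ Bminus F → ∀ τ ∈ F.dom t c, τ ≤ s → F.X τ s x < F.X τ t c := by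
    intro x hx τ hτ hτs
    have hdom := F.Iic_subset_dom_of_mem_Bminus hcont hε hem hx
    refine F.lt_of_lt (hdom hts) (F.mem_dom t c) (hdom hτs) hτ ?_
    rw [F.init]
    exact (F.le_of_mem_Bminus hcont hε hm hem
      (F.mem_Bminus_of_mem_dom hε hem hx (hdom hts))).trans_lt hmc
  have hupp : ∀ τ ∈ F.dom t c, τ ∈ Icc t s → F.X τ t c < F.X τ s a := fun τ hτ hτs =>
    F.lt_of_lt (F.mem_dom t c) ht hτ (hsubset hτs) (by rwa [F.init])
  obtain ⟨x₁, hx₁⟩ := hs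
  obtain ⟨C₁, hC₁⟩ := F.exists_abs_le_of_mem_Bminus hε hem hx₁
  obtain ⟨C₂, hC₂⟩ := (isCompact_Icc (a := t) (b := s)).exists_bound_of_continuousOn
    ((F.continuousOn s a).mono hsubset)
  have hsc : s ∈ F.dom t c := by
    refine F.mem_dom_of_bounded_forward hcont (C := max C₁ C₂) hts fun τ hτ hτs => abs_le.2 ⟨?_, ?_⟩
    · have h1 := hlow x₁ hx₁ τ hτ hτs.2
      have h2 := (abs_le.1 (hC₁ τ (F.Iic_subset_dom_of_mem_Bminus hcont hε hem hx₁ hτs.2) hτs.2)).1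
      linarith [le_max_left C₁ C₂]
    · have h1 := hupp τ hτ hτs
      have h2 := (abs_le.1 (hC₂ τ hτs)).2
      linarith [le_max_right C₁ C₂]
  have h1 := hupp s hsc ⟨hts, le_rfl⟩
  rw [F.init] at h1
  obtain ⟨x, hx, hx'⟩ := exists_lt_of_lt_csSup ⟨x₁, hx₁⟩ h1
  have h2 := hlow x hx s hsc le_rfl
  rw [F.init] at h2
  exact h2.not_gt hx'

/-- The supremum of the fibre of `Bminus F` over `s`. -/
noncomputable def upperBound (F : MaxSolFamily h) (s : ℝ) : ℝ :=
  sSup {x | (s, x) ∈ Bminus F}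

lemma mem_Bminus_iff_le_upperBound (hcont : Continuous fun q : ℝ × ℝ => h q.1 q.2) (hε : 0 < ε)
    (hm : 0 < m) (hem : ∀ t x : ℝ, m ≤ x → h t x ≤ -ε ∧ h t (-x) ≤ -ε)
    (F : MaxSolFamily h) {s : ℝ} (hs : s ∈ Rminus F) (x : ℝ) :
    (s, x) ∈ Bminus F ↔ x ≤ F.upperBound s :=
  ⟨fun hx => le_csSup ⟨m, fun _ hy => F.le_of_mem_Bminus hcont hε hm hem hy⟩ hx,
    fun hx => F.mem_Bminus_of_le hcont hε hem (F.sSup_mem_Bminus hcont hε hm hem hs) hx⟩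

lemma upperBound_eq_of_le (hcont : Continuous fun q : ℝ × ℝ => h q.1 q.2) (hε : 0 < ε)
    (hm : 0 < m) (hem : ∀ t x : ℝ, m ≤ x → h t x ≤ -ε ∧ h t (-x) ≤ -ε)
    (F : MaxSolFamily h) {s t : ℝ} (hs : s ∈ Rminus F) (hts : t ≤ s) :
    F.upperBound t = F.X t s (F.upperBound s) := by
  have ha : (s, F.upperBound s) ∈ Bminus F := F.sSup_mem_Bminus hcont hε hm hem hs
  have hdom := F.Iic_subset_dom_of_mem_Bminus hcont hε hem ha
  have hB := F.mem_Bminus_of_mem_dom hε hem ha (hdom hts)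
  have htR : t ∈ Rminus F := ⟨_, hB⟩
  have hat : (t, F.upperBound t) ∈ Bminus F := F.sSup_mem_Bminus hcont hε hm hem htR
  refine le_antisymm ?_ ((F.mem_Bminus_iff_le_upperBound hcont hε hm hem htR _).1 hB)
  by_contra! hlt
  have hlow : ∀ τ ∈ F.dom t (F.upperBound t), τ ≤ s →
      F.X τ s (F.upperBound s) < F.X τ t (F.upperBound t) := fun τ hτ hτs =>
    F.lt_of_lt (hdom hts) (F.mem_dom _ _) (hdom hτs) hτ (by rwa [F.init])
  obtain ⟨C, hC⟩ := F.exists_abs_le_of_mem_Bminus hε hem ha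
  have hst : s ∈ F.dom t (F.upperBound t) := by
    refine F.mem_dom_of_bounded_forward hcont (C := max C m) hts
      fun τ hτ hτs => abs_le.2 ⟨?_, ?_⟩
    · have h1 := (abs_le.1 (hC τ (hdom hτs.2) hτs.2)).1
      linarith [hlow τ hτ hτs.2, le_max_left C m]
    · exact (F.le_of_mem_Bminus hcont hε hm hem
        (F.mem_Bminus_of_mem_dom hε hem hat hτ)).trans (le_max_right _ _)
  have h1 := hlow s hst le_rfl
  rw [F.init] at h1
  exact h1.not_ge ((F.mem_Bminus_iff_le_upperBound hcont hε hm hem hs _).1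
    (F.mem_Bminus_of_mem_dom hε hem hat hst))

lemma upperBound_eq_of_mem_dom (hcont : Continuous fun q : ℝ × ℝ => h q.1 q.2) (hε : 0 < ε)
    (hm : 0 < m) (hem : ∀ t x : ℝ, m ≤ x → h t x ≤ -ε ∧ h t (-x) ≤ -ε)
    (F : MaxSolFamily h) {s t : ℝ} (hs : s ∈ Rminus F) (ht : t ∈ F.dom s (F.upperBound s)) :
    t ∈ Rminus F ∧ F.upperBound t = F.X t s (F.upperBound s) := by
  have ha : (s, F.upperBound s) ∈ Bminus F := F.sSup_mem_Bminus hcont hε hm hem hs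
  have htR : t ∈ Rminus F := ⟨_, F.mem_Bminus_of_mem_dom hε hem ha ht⟩
  refine ⟨htR, ?_⟩
  rcases le_total t s with hts | hst
  · exact F.upperBound_eq_of_le hcont hε hm hem hs hts
  · have hat : (t, F.upperBound t) ∈ Bminus F := F.sSup_mem_Bminus hcont hε hm hem htR
    have hs' := F.Iic_subset_dom_of_mem_Bminus hcont hε hem hat hst
    rw [F.upperBound_eq_of_le hcont hε hm hem htR hst,
      ← (F.dom_subset_of_mem hs').2 t (F.mem_dom _ _), F.init]

lemma hasDerivAt_upperBound (hcont : Continuous fun q : ℝ × ℝ => h q.1 q.2) (hε : 0 < ε)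
    (hm : 0 < m) (hem : ∀ t x : ℝ, m ≤ x → h t x ≤ -ε ∧ h t (-x) ≤ -ε)
    (F : MaxSolFamily h) {s : ℝ} (hs : s ∈ Rminus F) :
    HasDerivAt F.upperBound (h s (F.upperBound s)) s := by
  have hd := F.sol s (F.upperBound s) s (F.mem_dom _ _)
  rw [F.init] at hd
  refine hd.congr_of_eventuallyEq ?_
  filter_upwards [(F.dom_open s (F.upperBound s)).mem_nhds (F.mem_dom _ _)] with t ht
  exact (F.upperBound_eq_of_mem_dom hcont hε hm hem hs ht).2

lemma bddAtBot_iff_mem_Bminus (hcont : Continuous fun q : ℝ × ℝ => h q.1 q.2) (hε : 0 < ε)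
    (hem : ∀ t x : ℝ, m ≤ x → h t x ≤ -ε ∧ h t (-x) ≤ -ε)
    (F : MaxSolFamily h) (s x : ℝ) : BddAtBot F s x ↔ (s, x) ∈ Bminus F := by
  constructor
  · rintro ⟨C, hC⟩
    obtain ⟨T, hT⟩ := eventually_atBot.1 hC
    obtain ⟨C', hC'⟩ := (isCompact_Icc (a := T) (b := s)).exists_bound_of_continuousOn
      ((F.continuousOn s x).mono ((F.dom_ordConn s x).out (hT T le_rfl).1 (F.mem_dom s x)))
    refine F.mem_Bminus_iff.2 ⟨max C C', fun t _ hts => ?_⟩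
    rcases le_total t T with htT | htT
    · exact ((le_abs_self _).trans (hT t htT).2).trans (le_max_left _ _)
    · exact ((le_abs_self _).trans (hC' t ⟨htT, hts⟩)).trans (le_max_right _ _)
  · intro hx
    have hdom := F.Iic_subset_dom_of_mem_Bminus hcont hε hem hx
    obtain ⟨C, hC⟩ := F.exists_abs_le_of_mem_Bminus hε hem hx
    refine ⟨C, ?_⟩
    filter_upwards [Iic_mem_atBot s] with t ht using ⟨hdom ht, hC t (hdom ht) ht⟩

lemma Rminus_eq_univ_or_Iio (hcont : Continuous fun q : ℝ × ℝ => h q.1 q.2) (hε : 0 < ε)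
    (hm : 0 < m) (hem : ∀ t x : ℝ, m ≤ x → h t x ≤ -ε ∧ h t (-x) ≤ -ε)
    (F : MaxSolFamily h) (hne : (Bminus F).Nonempty) :
    Rminus F = univ ∨ ∃ β, Rminus F = Iio β := by
  have hlower : ∀ s ∈ Rminus F, ∀ t ≤ s, t ∈ Rminus F := by
    rintro s ⟨x, hx⟩ t hts
    exact ⟨_, F.mem_Bminus_of_mem_dom hε hem hx
      (F.Iic_subset_dom_of_mem_Bminus hcont hε hem hx hts)⟩
  have hopen : IsOpen (Rminus F) := isOpen_iff_mem_nhds.2 fun s hs =>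
    mem_of_superset ((F.dom_open s (F.upperBound s)).mem_nhds (F.mem_dom _ _))
      fun t ht => (F.upperBound_eq_of_mem_dom hcont hε hm hem hs ht).1
  obtain ⟨⟨s₀, x₀⟩, h₀⟩ := hne
  have hnonempty : (Rminus F).Nonempty := ⟨s₀, x₀, h₀⟩
  by_cases hb : BddAbove (Rminus F)
  · refine Or.inr ⟨sSup (Rminus F), Subset.antisymm (fun s hs => ?_) fun s hs => ?_⟩
    · obtain ⟨u, hu, hu'⟩ := exists_Ico_subset_of_mem_nhds (hopen.mem_nhds hs) ⟨s + 1, by linarith⟩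
      obtain ⟨t, hst, htu⟩ := exists_between hu
      exact hst.trans_le (le_csSup hb (hu' ⟨hst.le, htu⟩))
    · obtain ⟨t, ht, hst⟩ := exists_lt_of_lt_csSup hnonempty hs
      exact hlower t ht s hst.le
  · refine Or.inl (eq_univ_of_forall fun s => ?_)
    obtain ⟨t, ht, hst⟩ := not_bddAbove_iff.1 hb s
    exact hlower t ht s hst.le

lemma tendsto_upperBound_atBot (hcont : Continuous fun q : ℝ × ℝ => h q.1 q.2) (hε : 0 < ε)
    (hm : 0 < m) (hem : ∀ t x : ℝ, m ≤ x → h t x ≤ -ε ∧ h t (-x) ≤ -ε)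
    (F : MaxSolFamily h) {β : ℝ} (hβ : Rminus F = Iio β) :
    Tendsto F.upperBound (nhdsWithin β (Iio β)) atBot := by
  refine tendsto_atBot.2 fun N => ?_
  set K := max m (-N)
  have hmem : ∀ s ∈ Rminus F, (s, F.upperBound s) ∈ Bminus F := fun s hs =>
    F.sSup_mem_Bminus hcont hε hm hem hs
  obtain ⟨s, hs, hsK⟩ : ∃ s < β, F.upperBound s ≤ -K := by
    by_contra! H
    have hs : β - 1 ∈ Rminus F := hβ ▸ (by simp : β - 1 ∈ Iio β)
    have hdom : β ∈ F.dom (β - 1) (F.upperBound (β - 1)) := by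
      refine F.mem_dom_of_bounded_forward hcont (C := K) (by linarith) fun t ht _ => ?_
      obtain ⟨htR, hteq⟩ := F.upperBound_eq_of_mem_dom hcont hε hm hem hs ht
      rw [← hteq]
      have htβ : t < β := by rwa [hβ] at htR
      exact abs_le.2 ⟨(H t htβ).le, (F.le_of_mem_Bminus hcont hε hm hem (hmem t htR)).trans
        (le_max_left _ _)⟩
    have := (F.upperBound_eq_of_mem_dom hcont hε hm hem hs hdom).1
    rw [hβ] at this
    exact lt_irrefl β this
  filter_upwards [Ioo_mem_nhdsLT hs] with t ht
  have htR : t ∈ Rminus F := hβ ▸ ht.2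
  have hst := F.Iic_subset_dom_of_mem_Bminus hcont hε hem (hmem t htR) ht.1.le
  have h1 := F.forward_le (c := -K)
    (fun τ => (hem τ K (le_max_left _ _)).2.trans_lt (by linarith)) hst (F.mem_dom _ _) ht.1.le
    (by rwa [← F.upperBound_eq_of_le hcont hε hm hem htR ht.1.le])
  rw [F.init] at h1
  linarith [le_max_right m (-N)]

end Decay

end MaxSolFamily

theorem stmt0 (h : ℝ → ℝ → ℝ)
    (hcont : Continuous fun q : ℝ × ℝ => h q.1 q.2)
    (hlip : ∀ q : ℝ × ℝ, ∃ K : ℝ, ∃ U ∈ nhds q, ∀ t x y : ℝ,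
      (t, x) ∈ U → (t, y) ∈ U → |h t x - h t y| ≤ K * |x - y|)
    (hcoer : ∃ μ > (0:ℝ), ∃ M > (0:ℝ), ∀ t x : ℝ, M ≤ |x| → h t x ≤ -μ * x ^ 2)
    (F : MaxSolFamily h)
    (ε m : ℝ) (hε : 0 < ε) (hm : 0 < m)
    (hem : ∀ t x : ℝ, m ≤ x → h t x ≤ -ε ∧ h t (-x) ≤ -ε)
    (hne : (Bminus F).Nonempty) :
    (Rminus F = Set.univ ∨ ∃ β₀ : ℝ, Rminus F = Set.Iio β₀) ∧
    ∃ a : ℝ → ℝ,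
      (∀ s ∈ Rminus F, a s < m) ∧
      (∀ t ∈ Rminus F, HasDerivAt a (h t (a t)) t) ∧
      (∀ s ∈ Rminus F, ∀ x₀ : ℝ, (s, x₀) ∈ Bminus F ↔ x₀ ≤ a s) ∧
      (∀ s ∈ Rminus F, ∀ x₀ : ℝ, BddAtBot F s x₀ ↔ x₀ ≤ a s) ∧
      (∀ β₀ : ℝ, Rminus F = Set.Iio β₀ →
        Filter.Tendsto a (nhdsWithin β₀ (Set.Iio β₀)) Filter.atBot) := by
  exact ⟨F.Rminus_eq_univ_or_Iio hcont hε hm hem hne, F.upperBound,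
    fun s hs => F.lt_of_mem_Bminus hcont hε hm hem (F.sSup_mem_Bminus hcont hε hm hem hs),
    fun t ht => F.hasDerivAt_upperBound hcont hε hm hem ht,
    fun s hs => F.mem_Bminus_iff_le_upperBound hcont hε hm hem hs,
    fun s hs x₀ => (F.bddAtBot_iff_mem_Bminus hcont hε hem s x₀).trans
      (F.mem_Bminus_iff_le_upperBound hcont hε hm hem hs x₀),
    fun β₀ hβ => F.tendsto_upperBound_atBot hcont hε hm hem hβ⟩
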